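/- Let 0 < r ≤ 1, let T : X → Y be an r-nuclear operator and U : Y → X a nuclear (1-nuclear) operator between Banach spaces. Then the eigenvalue sequence of the composition U∘T : X → X belongs to ℓ^r. -/

import Mathlib

open scoped ENNReal NNReal ComplexConjugate
open MeasureTheory

noncomputable section

/-- The `n`-th approximation number (indexed from `0`, so that `opApproxNum U n`
is the classical `(n+1)`-st approximation number `a_{n+1}(U)`):
the distance from `U` to operators of rank at most `n`.
For operators between Hilbert spaces, the approximation numbers coincide with the
singular numbers. -/
def opApproxNum {H K : Type*} [SeminormedAddCommGroup H] [NormedSpace ℂ H]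
    [SeminormedAddCommGroup K] [NormedSpace ℂ K] (U : H →L[ℂ] K) (n : ℕ) : ℝ :=
  sInf { c : ℝ | ∃ F : H →L[ℂ] K,
    FiniteDimensional ℂ (LinearMap.range (F : H →ₗ[ℂ] K)) ∧
    Module.finrank ℂ (LinearMap.range (F : H →ₗ[ℂ] K)) ≤ n ∧ ‖U - F‖ = c }

/-- Membership in the Schatten class `S_p` of a Hilbert space, `p ∈ (0,∞]`:
for finite `p` the operator is compact with singular numbers (= approximation numbers)
in `ℓ^p`; following the convention of the paper, `S_∞` means all bounded operators. -/
def MemSchatten {H : Type*} [NormedAddCommGroup H] [InnerProductSpace ℂ H]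
    (p : ℝ≥0∞) (U : H →L[ℂ] H) : Prop :=
  p = ∞ ∨ (IsCompactOperator U ∧ Summable fun n : ℕ => opApproxNum U n ^ p.toReal)

/-- The Schatten quasi-norm `σ_p`; for `p = ∞` it is the operator norm. -/
def schattenNorm {H : Type*} [NormedAddCommGroup H] [InnerProductSpace ℂ H]
    (p : ℝ≥0∞) (U : H →L[ℂ] H) : ℝ :=
  if p = ∞ then ‖U‖ else (∑' n : ℕ, opApproxNum U n ^ p.toReal) ^ (1 / p.toReal)

/-- `T : X → Y` factors through an `S_p`-operator on a Hilbert space. -/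
def FactorsThroughSchatten {X Y : Type*} [SeminormedAddCommGroup X] [NormedSpace ℂ X]
    [SeminormedAddCommGroup Y] [NormedSpace ℂ Y] (p : ℝ≥0∞) (T : X →L[ℂ] Y) : Prop :=
  ∃ (H : Type) (_ : NormedAddCommGroup H) (_ : InnerProductSpace ℂ H) (_ : CompleteSpace H)
    (B : X →L[ℂ] H) (U : H →L[ℂ] H) (A : H →L[ℂ] Y),
    MemSchatten p U ∧ ∀ x, A (U (B x)) = T x

/-- `T : X → Y` factors through a (bounded operator on a) Hilbert space. -/
def FactorsThroughHilbert {X Y : Type*} [SeminormedAddCommGroup X] [NormedSpace ℂ X]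
    [SeminormedAddCommGroup Y] [NormedSpace ℂ Y] (T : X →L[ℂ] Y) : Prop :=
  ∃ (H : Type) (_ : NormedAddCommGroup H) (_ : InnerProductSpace ℂ H) (_ : CompleteSpace H)
    (A : X →L[ℂ] H) (B : H →L[ℂ] Y), ∀ x, B (A x) = T x

/-- `T` is `r`-absolutely summing: `Σ ‖T x_n‖^r ≤ C^r · sup_{‖x'‖≤1} Σ |⟨x_n, x'⟩|^r`
(the supremum is expressed through its upper bounds). -/
def AbsSumming {X Y : Type*} [SeminormedAddCommGroup X] [NormedSpace ℂ X]
    [SeminormedAddCommGroup Y] [NormedSpace ℂ Y] (r : ℝ) (T : X →L[ℂ] Y) : Prop :=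
  ∃ C : ℝ, 0 < C ∧ ∀ (N : ℕ) (x : Fin N → X) (b : ℝ),
    (∀ x' : X →L[ℂ] ℂ, ‖x'‖ ≤ 1 → ∑ n, ‖x' (x n)‖ ^ r ≤ b) →
    ∑ n, ‖T (x n)‖ ^ r ≤ C ^ r * b

/-- `T` is `r`-nuclear (`0 < r ≤ 1`): `T x = Σ μ_n ⟨x'_n, x⟩ y_n` with `‖x'_n‖ ≤ 1`,
`‖y_n‖ ≤ 1` and `(μ_n) ∈ ℓ^r`. -/
def RNuclear {X Y : Type*} [SeminormedAddCommGroup X] [NormedSpace ℂ X]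
    [SeminormedAddCommGroup Y] [NormedSpace ℂ Y] (r : ℝ) (T : X →L[ℂ] Y) : Prop :=
  ∃ (μ : ℕ → ℂ) (x' : ℕ → X →L[ℂ] ℂ) (y : ℕ → Y),
    (∀ n, ‖x' n‖ ≤ 1) ∧ (∀ n, ‖y n‖ ≤ 1) ∧
    (Summable fun n => ‖μ n‖ ^ r) ∧
    ∀ x, T x = ∑' n, (μ n * x' n x) • y n

/-- The `r`-nuclear quasi-norm `ν_r(T)`. -/
def nuclearNorm {X Y : Type*} [SeminormedAddCommGroup X] [NormedSpace ℂ X]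
    [SeminormedAddCommGroup Y] [NormedSpace ℂ Y] (r : ℝ) (T : X →L[ℂ] Y) : ℝ :=
  sInf { c : ℝ | ∃ (μ : ℕ → ℂ) (x' : ℕ → X →L[ℂ] ℂ) (y : ℕ → Y),
    (∀ n, ‖x' n‖ ≤ 1) ∧ (∀ n, ‖y n‖ ≤ 1) ∧
    (Summable fun n => ‖μ n‖ ^ r) ∧
    (∀ x, T x = ∑' n, (μ n * x' n x) • y n) ∧
    (∑' n, ‖μ n‖ ^ r) ^ (1 / r) = c }

/-- `ℓ²` over `ℕ`. -/
abbrev ell2 : Type := lp (fun _ : ℕ => ℂ) 2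

end

noncomputable section

/-- The algebraic multiplicity of `μ` as an eigenvalue of `S`: the dimension of the
generalized eigenspace `⋃_k ker (S - μ)^k`. -/
def algebraicMultiplicity {Z : Type*} [NormedAddCommGroup Z] [NormedSpace ℂ Z]
    (S : Z →L[ℂ] Z) (μ : ℂ) : ℕ :=
  Module.finrank ℂ
    ↥(⨆ k : ℕ, LinearMap.ker ((((S - μ • (1 : Z →L[ℂ] Z)) ^ k : Z →L[ℂ] Z)) : Z →ₗ[ℂ] Z))

/-- `lam` is (an enumeration of) the eigenvalue sequence of `S`: the sequence of all
(nonzero) eigenvalues of `S`, each counted according to its algebraic multiplicity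
(entries equal to `0` serve as padding). -/
def IsEigenvalueSeq {Z : Type*} [NormedAddCommGroup Z] [NormedSpace ℂ Z]
    (S : Z →L[ℂ] Z) (lam : ℕ → ℂ) : Prop :=
  (∀ n, lam n ≠ 0 → ∃ x : Z, x ≠ 0 ∧ S x = lam n • x) ∧
  (∀ μ : ℂ, μ ≠ 0 → Nat.card {n : ℕ // lam n = μ} = algebraicMultiplicity S μ)

end

section TriangularMaps

variable {ι : Type*} [LinearOrder ι]

theorem map_mem_span_Iio_of_triangular {E F : Type*} [AddCommGroup E] [Module ℂ E]
    [AddCommGroup F] [Module ℂ F] {L : E →ₗ[ℂ] F} {u : ι → E} {w : ι → F} {c : ι → ℂ}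
    (h : ∀ i, L (u i) - c i • w i ∈ Submodule.span ℂ (w '' Set.Iio i)) {i : ι} {x : E}
    (hx : x ∈ Submodule.span ℂ (u '' Set.Iio i)) :
    L x ∈ Submodule.span ℂ (w '' Set.Iio i) := by
  suffices hle : Submodule.span ℂ (u '' Set.Iio i) ≤
      (Submodule.span ℂ (w '' Set.Iio i)).comap L from hle hx
  rw [Submodule.span_le]
  rintro _ ⟨j, hj, rfl⟩
  have hj' : j < i := hj
  rw [SetLike.mem_coe, Submodule.mem_comap, ← sub_add_cancel (L (u j)) (c j • w j)]
  refine Submodule.add_mem _ ?_ (Submodule.smul_mem _ _ (Submodule.subset_span ⟨j, hj, rfl⟩))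
  exact Submodule.span_mono (Set.image_mono (Set.Iio_subset_Iio hj'.le)) (h j)

/-- A triangular family with nonzero diagonal coefficients is mapped to a linearly independent
family. -/
theorem linearIndependent_of_triangular [Fintype ι] [WellFoundedLT ι] {E : Type*}
    [AddCommGroup E] [Module ℂ E] {L : E →ₗ[ℂ] E} {v : ι → E} {c : ι → ℂ}
    (hv : LinearIndependent ℂ v) (hc : ∀ i, c i ≠ 0)
    (h : ∀ i, L (v i) - c i • v i ∈ Submodule.span ℂ (v '' Set.Iio i)) :
    LinearIndependent ℂ fun i => L (v i) := by
  have hle : Submodule.span ℂ (Set.range v) ≤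
      Submodule.span ℂ (Set.range fun i => L (v i)) := by
    rw [Submodule.span_le]
    rintro _ ⟨i, rfl⟩
    induction i using WellFoundedLT.induction with
    | ind i ih =>
      have h1 : L (v i) - c i • v i ∈ Submodule.span ℂ (Set.range fun i => L (v i)) := by
        refine Submodule.span_le.2 ?_ (h i)
        rintro _ ⟨j, hj, rfl⟩
        exact ih j hj
      have h2 : c i • v i ∈ Submodule.span ℂ (Set.range fun i => L (v i)) := by
        have h3 := Submodule.sub_mem _
          (Submodule.subset_span (Set.mem_range_self (f := fun i => L (v i)) i)) h1
        simpa using h3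
      exact (Submodule.smul_mem_iff _ (hc i)).1 h2
  rw [linearIndependent_iff_card_le_finrank_span]
  rw [linearIndependent_iff_card_eq_finrank_span] at hv
  rw [hv]
  have : FiniteDimensional ℂ (Submodule.span ℂ (Set.range fun i => L (v i))) :=
    FiniteDimensional.span_of_finite ℂ (Set.finite_range _)
  exact Submodule.finrank_mono hle

open InnerProductSpace in
theorem sub_gramSchmidt_mem_span_Iio [LocallyFiniteOrderBot ι] [WellFoundedLT ι] {E : Type*}
    [NormedAddCommGroup E] [InnerProductSpace ℂ E] (f : ι → E) (i : ι) :
    f i - gramSchmidt ℂ f i ∈ Submodule.span ℂ (f '' Set.Iio i) := by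
  rw [← span_gramSchmidt_Iio ℂ f i, sub_eq_iff_eq_add'.2 (gramSchmidt_def'' ℂ f i)]
  exact Submodule.sum_mem _ fun j hj => Submodule.smul_mem _ _
    (Submodule.subset_span ⟨j, Finset.mem_Iio.1 hj, rfl⟩)

open InnerProductSpace in
/-- The diagonal of a triangular map with respect to Gram-Schmidt bases. -/
theorem norm_inner_gramSchmidtNormed_of_triangular [LocallyFiniteOrderBot ι] [WellFoundedLT ι]
    {E F : Type*} [NormedAddCommGroup E] [InnerProductSpace ℂ E]
    [NormedAddCommGroup F] [InnerProductSpace ℂ F] {L : E →ₗ[ℂ] F} {u : ι → E} {w : ι → F}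
    {c : ι → ℂ} (h : ∀ i, L (u i) - c i • w i ∈ Submodule.span ℂ (w '' Set.Iio i)) (i : ι) :
    ‖inner ℂ (gramSchmidtNormed ℂ w i) (L (gramSchmidtNormed ℂ u i))‖ =
      ‖c i‖ * (‖gramSchmidt ℂ w i‖ / ‖gramSchmidt ℂ u i‖) := by
  have key : ∀ y ∈ Submodule.span ℂ (w '' Set.Iio i), inner ℂ (gramSchmidt ℂ w i) y = 0 := by
    intro y hy
    induction hy using Submodule.span_induction with
    | mem x hx =>
      obtain ⟨j, hj, rfl⟩ := hx
      exact gramSchmidt_inv_triangular ℂ w hj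
    | zero => simp
    | add x y _ _ hx hy => rw [inner_add_right, hx, hy, add_zero]
    | smul a x _ hx => rw [inner_smul_right, hx, mul_zero]
  have hself : inner ℂ (gramSchmidt ℂ w i) (w i) = (‖gramSchmidt ℂ w i‖ : ℂ) ^ 2 := by
    have h1 := key _ (sub_gramSchmidt_mem_span_Iio w i)
    rw [inner_sub_right, sub_eq_zero] at h1
    rw [h1, inner_self_eq_norm_sq_to_K]
    rfl
  have hL : inner ℂ (gramSchmidt ℂ w i) (L (gramSchmidt ℂ u i)) =
      c i * (‖gramSchmidt ℂ w i‖ : ℂ) ^ 2 := by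
    have h1 := key _ (map_mem_span_Iio_of_triangular h (sub_gramSchmidt_mem_span_Iio u i))
    have h2 := key _ (h i)
    rw [map_sub, inner_sub_right, sub_eq_zero] at h1
    rw [inner_sub_right, sub_eq_zero, inner_smul_right, hself] at h2
    rw [← h1, h2]
  rw [gramSchmidtNormed, gramSchmidtNormed, map_smul, inner_smul_left, inner_smul_right, hL]
  simp only [norm_mul, norm_pow, norm_inv, RCLike.norm_conj, Complex.norm_real, norm_norm, Complex.coe_algebraMap]
  rcases eq_or_ne (‖gramSchmidt ℂ w i‖) 0 with h0 | h0
  · simp [h0]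
  · field_simp

end TriangularMaps

section SquareSummable

theorem ell2.summable_norm_sq (z : ell2) : Summable fun n => ‖z n‖ ^ 2 := by
  simpa using (lp.memℓp z).summable (by simp)

theorem ell2.norm_sq_eq_tsum (z : ell2) : ‖z‖ ^ 2 = ∑' n, ‖z n‖ ^ 2 := by
  simpa using lp.norm_rpow_eq_tsum (p := 2) (by simp) z

theorem memℓp_two_of_summable {f : ℕ → ℂ} (hf : Summable fun n => ‖f n‖ ^ 2) :
    Memℓp f 2 :=
  memℓp_gen (by simpa using hf)

/-- A square summable sequence of functionals defines a map into `ℓ²`. -/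
theorem exists_analysis_map {X : Type*} [NormedAddCommGroup X] [NormedSpace ℂ X]
    {φ : ℕ → X →L[ℂ] ℂ} (hφ : Summable fun n => ‖φ n‖ ^ 2) :
    ∃ P : X →ₗ[ℂ] ell2, ∀ x n, P x n = φ n x := by
  have hmem : ∀ x, Memℓp (fun n => φ n x) 2 := fun x => by
    refine memℓp_two_of_summable (Summable.of_nonneg_of_le (fun _ => by positivity)
      (fun n => ?_) (hφ.mul_right (‖x‖ ^ 2)))
    rw [← mul_pow]
    exact pow_le_pow_left₀ (norm_nonneg _) ((φ n).le_opNorm x) 2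
  refine ⟨{ toFun := fun x => ⟨fun n => φ n x, hmem x⟩, map_add' := ?_, map_smul' := ?_ },
    fun x n => rfl⟩
  · intro x y
    ext n
    exact map_add (φ n) x y
  · intro c x
    ext n
    exact map_smul (φ n) c x

/-- A square summable sequence of vectors defines a bounded operator on `ℓ²`. -/
theorem exists_synthesis_map {Y : Type*} [NormedAddCommGroup Y] [NormedSpace ℂ Y]
    [CompleteSpace Y] {y : ℕ → Y} (hy : Summable fun n => ‖y n‖ ^ 2) :
    ∃ Q : ell2 →L[ℂ] Y, ∀ z, Q z = ∑' n, z n • y n := by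
  have hh : ∀ z : ell2, (Summable fun n => ‖z n‖ * ‖y n‖) ∧
      ∑' n, ‖z n‖ * ‖y n‖ ≤ (∑' n, ‖y n‖ ^ 2) ^ (1 / (2 : ℝ)) * ‖z‖ := fun z => by
    have h := Real.summable_and_inner_le_Lp_mul_Lq_tsum_of_nonneg Real.HolderConjugate.two_two
      (f := fun n => ‖z n‖) (g := fun n => ‖y n‖) (fun _ => norm_nonneg _)
      (fun _ => norm_nonneg _) (by simpa using ell2.summable_norm_sq z) (by simpa using hy)
    refine ⟨h.1, h.2.trans_eq ?_⟩
    simp only [Real.rpow_two]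
    rw [← ell2.norm_sq_eq_tsum, ← Real.sqrt_eq_rpow, Real.sqrt_sq (norm_nonneg _), mul_comm]
  have hs : ∀ z : ell2, Summable fun n => z n • y n := fun z =>
    Summable.of_norm (by simpa only [norm_smul] using (hh z).1)
  let Q : ell2 →ₗ[ℂ] Y :=
    { toFun := fun z => ∑' n, z n • y n
      map_add' := fun z w => by
        rw [← (hs z).tsum_add (hs w)]
        exact tsum_congr fun n => add_smul _ _ _
      map_smul' := fun c z => by
        rw [RingHom.id_apply, ← (hs z).tsum_const_smul c]
        exact tsum_congr fun n => smul_assoc c (z n) (y n) }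
  refine ⟨Q.mkContinuous ((∑' n, ‖y n‖ ^ 2) ^ (1 / (2 : ℝ))) fun z => ?_, fun z => rfl⟩
  refine le_trans ?_ (hh z).2
  refine (norm_tsum_le_tsum_norm (by simpa only [norm_smul] using (hh z).1)).trans_eq ?_
  exact tsum_congr fun n => norm_smul _ _

/-- A bounded sequence defines a diagonal operator on `ℓ²`. -/
theorem exists_diagonal_map {d : ℕ → ℝ} {K : ℝ} (hd : ∀ n, |d n| ≤ K) :
    ∃ D : ell2 →ₗ[ℂ] ell2, ∀ z n, D z n = d n * z n := by
  have hmem : ∀ z : ell2, Memℓp (fun n => (d n : ℂ) * z n) 2 := fun z => by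
    refine memℓp_two_of_summable (Summable.of_nonneg_of_le (fun _ => by positivity)
      (fun n => ?_) ((ell2.summable_norm_sq z).mul_left (K ^ 2)))
    rw [norm_mul, mul_pow, Complex.norm_real]
    gcongr
    exact hd n
  refine ⟨{ toFun := fun z => ⟨fun n => d n * z n, hmem z⟩, map_add' := ?_, map_smul' := ?_ },
    fun z n => rfl⟩
  · intro x y
    ext n
    exact mul_add _ _ _
  · intro c x
    ext n
    exact mul_left_comm _ _ _

variable {ι : Type*} [Fintype ι]

theorem Orthonormal.sum_norm_apply_sq_le {H : Type*} [NormedAddCommGroup H]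
    [InnerProductSpace ℂ H] [CompleteSpace H] {e : ι → H} (he : Orthonormal ℂ e)
    (β : H →L[ℂ] ℂ) : ∑ i, ‖β (e i)‖ ^ 2 ≤ ‖β‖ ^ 2 := by
  have h := he.sum_inner_products_le ((InnerProductSpace.toDual ℂ H).symm β)
    (s := Finset.univ)
  rw [LinearIsometryEquiv.norm_map] at h
  refine le_trans (Finset.sum_le_sum fun i _ => ?_) h
  rw [norm_inner_symm, InnerProductSpace.toDual_symm_apply]

/-- The Hilbert-Schmidt bound for an operator on `ℓ²` factoring through a square summable
sequence of functionals. -/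
theorem sum_norm_inner_analysis_sq_le {X : Type*} [NormedAddCommGroup X] [NormedSpace ℂ X]
    {φ : ℕ → X →L[ℂ] ℂ} (hφ : Summable fun n => ‖φ n‖ ^ 2) {P : X →ₗ[ℂ] ell2}
    (hP : ∀ x n, P x n = φ n x) (Q : ell2 →L[ℂ] X) {e f : ι → ell2}
    (he : Orthonormal ℂ e) (hf : Orthonormal ℂ f) :
    ∑ i, ‖inner ℂ (f i) (P (Q (e i)))‖ ^ 2 ≤ ∑' n, ‖φ n‖ ^ 2 * ‖Q‖ ^ 2 := by
  have hs : ∀ i, Summable fun n => ‖φ n (Q (e i))‖ ^ 2 := fun i => by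
    simpa only [hP] using ell2.summable_norm_sq (P (Q (e i)))
  calc ∑ i, ‖inner ℂ (f i) (P (Q (e i)))‖ ^ 2 ≤ ∑ i, ‖P (Q (e i))‖ ^ 2 := by
        refine Finset.sum_le_sum fun i _ => pow_le_pow_left₀ (norm_nonneg _) ?_ 2
        simpa [hf.1 i] using norm_inner_le_norm (𝕜 := ℂ) (f i) (P (Q (e i)))
    _ = ∑ i, ∑' n, ‖φ n (Q (e i))‖ ^ 2 := by
        simp only [ell2.norm_sq_eq_tsum, hP]
    _ = ∑' n, ∑ i, ‖φ n (Q (e i))‖ ^ 2 := (Summable.tsum_finsetSum fun i _ => hs i).symm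
    _ ≤ ∑' n, ‖φ n‖ ^ 2 * ‖Q‖ ^ 2 := by
        refine Summable.tsum_le_tsum (fun n => ?_) (summable_sum fun i _ => hs i)
          (hφ.mul_right _)
        refine (he.sum_norm_apply_sq_le ((φ n).comp Q)).trans ?_
        rw [← mul_pow]
        exact pow_le_pow_left₀ (norm_nonneg _) ((φ n).opNorm_comp_le Q) 2

theorem Orthonormal.sum_norm_coord_sq_le_one {e : ι → ell2} (he : Orthonormal ℂ e) (n : ℕ) :
    ∑ i, ‖e i n‖ ^ 2 ≤ 1 := by
  have h := he.sum_inner_products_le (lp.single 2 n (1 : ℂ)) (s := Finset.univ)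
  rw [lp.norm_single (by simp)] at h
  refine le_trans (Finset.sum_le_sum fun i _ => ?_) (h.trans_eq (by simp))
  rw [norm_inner_symm, lp.inner_single_left]
  simp

/-- Jensen's inequality for a countable probability distribution. -/
theorem rpow_tsum_mul_le_tsum_rpow_mul {d t : ℕ → ℝ} {p : ℝ} (hp : 1 ≤ p) (hd : ∀ n, 0 ≤ d n)
    (ht : ∀ n, 0 ≤ t n) (ht1 : HasSum t 1) (hdt : Summable fun n => d n * t n)
    (hdp : Summable fun n => d n ^ p * t n) :
    (∑' n, d n * t n) ^ p ≤ ∑' n, d n ^ p * t n := by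
  set x := ∑' n, d n * t n with hx
  have hx0 : 0 ≤ x := tsum_nonneg fun n => mul_nonneg (hd n) (ht n)
  rcases hx0.eq_or_lt with h0 | h0
  · rw [← h0, Real.zero_rpow (by linarith)]
    exact tsum_nonneg fun n => mul_nonneg (Real.rpow_nonneg (hd n) _) (ht n)
  have htan : ∀ n, x ^ p * (1 - p) * t n + x ^ p * p / x * (d n * t n) ≤ d n ^ p * t n := by
    intro n
    have hb := one_add_mul_self_le_rpow_one_add (s := d n / x - 1)
      (by have := div_nonneg (hd n) hx0; linarith) hp
    rw [add_sub_cancel, Real.div_rpow (hd n) hx0,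
      le_div_iff₀ (Real.rpow_pos_of_pos h0 p)] at hb
    refine le_trans (le_of_eq ?_) (mul_le_mul_of_nonneg_right hb (ht n))
    field_simp
    ring
  have hsum := (ht1.mul_left (x ^ p * (1 - p))).add (hdt.hasSum.mul_left (x ^ p * p / x))
  rw [← hx] at hsum
  have h := hasSum_le htan hsum hdp.hasSum
  refine le_trans (le_of_eq ?_) h
  field_simp
  ring

/-- The diagonal of a diagonal operator of `ℓ²` with respect to two orthonormal families. -/
theorem sum_norm_inner_diagonal_rpow_le {d : ℕ → ℝ} {p : ℝ} (hp : 1 ≤ p) (hd : ∀ n, 0 ≤ d n)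
    (hdp : Summable fun n => d n ^ p) {K : ℝ} (hK : ∀ n, |d n| ≤ K) {D : ell2 →ₗ[ℂ] ell2}
    (hD : ∀ z n, D z n = d n * z n) {e f : ι → ell2}
    (he : Orthonormal ℂ e) (hf : Orthonormal ℂ f) :
    ∑ i, ‖inner ℂ (f i) (D (e i))‖ ^ p ≤ ∑' n, d n ^ p := by
  let t : ι → ℕ → ℝ := fun i n => (‖f i n‖ ^ 2 + ‖e i n‖ ^ 2) / 2
  have ht : ∀ i n, 0 ≤ t i n := fun i n => by positivity
  have hsq : ∀ {g : ι → ell2}, Orthonormal ℂ g → ∀ i, HasSum (fun n => ‖g i n‖ ^ 2) 1 := by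
    intro g hg i
    have h := (ell2.summable_norm_sq (g i)).hasSum
    rwa [← ell2.norm_sq_eq_tsum, hg.1 i, one_pow] at h
  have ht1 : ∀ i, HasSum (t i) 1 := fun i => by
    simpa using ((hsq hf i).add (hsq he i)).div_const 2
  have htle : ∀ n, ∑ i, t i n ≤ 1 := fun n => by
    have h1 := he.sum_norm_coord_sq_le_one n
    have h2 := hf.sum_norm_coord_sq_le_one n
    rw [← Finset.sum_div, Finset.sum_add_distrib]
    linarith
  have htle1 : ∀ i n, t i n ≤ 1 := fun i n =>
    (Finset.single_le_sum (f := fun i => t i n) (fun j _ => ht j n)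
      (Finset.mem_univ i)).trans (htle n)
  have hdt : ∀ i, Summable fun n => d n * t i n := fun i =>
    Summable.of_nonneg_of_le (fun n => mul_nonneg (hd n) (ht i n))
      (fun n => mul_le_mul_of_nonneg_right ((le_abs_self _).trans (hK n)) (ht i n))
      ((ht1 i).summable.mul_left K)
  have hdpt : ∀ i, Summable fun n => d n ^ p * t i n := fun i =>
    Summable.of_nonneg_of_le (fun n => mul_nonneg (Real.rpow_nonneg (hd n) _) (ht i n))
      (fun n => mul_le_of_le_one_right (Real.rpow_nonneg (hd n) _) (htle1 i n)) hdp
  have hinner : ∀ i, ‖inner ℂ (f i) (D (e i))‖ ≤ ∑' n, d n * t i n := fun i => by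
    rw [← (lp.hasSum_inner (f i) (D (e i))).tsum_eq]
    refine tsum_of_norm_bounded (hdt i).hasSum fun n => ?_
    rw [hD]
    refine (norm_inner_le_norm _ _).trans ?_
    rw [norm_mul, Complex.norm_real, Real.norm_of_nonneg (hd n), mul_left_comm]
    refine mul_le_mul_of_nonneg_left ?_ (hd n)
    have := two_mul_le_add_sq (‖f i n‖) (‖e i n‖)
    simp only [t]
    linarith
  calc ∑ i, ‖inner ℂ (f i) (D (e i))‖ ^ p ≤ ∑ i, ∑' n, d n ^ p * t i n := by
        refine Finset.sum_le_sum fun i _ => ?_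
        refine (Real.rpow_le_rpow (norm_nonneg _) (hinner i) (by linarith)).trans ?_
        exact rpow_tsum_mul_le_tsum_rpow_mul hp hd (ht i) (ht1 i) (hdt i) (hdpt i)
    _ = ∑' n, ∑ i, d n ^ p * t i n := (Summable.tsum_finsetSum fun i _ => hdpt i).symm
    _ ≤ ∑' n, d n ^ p := by
        refine Summable.tsum_le_tsum (fun n => ?_) (summable_sum fun i _ => hdpt i) hdp
        rw [← Finset.mul_sum]
        exact mul_le_of_le_one_right (Real.rpow_nonneg (hd n) _) (htle n)

end SquareSummable

section NuclearFactorization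

theorem exists_nat_real_add_mul_div_eq_one {r : ℝ} (hr0 : 0 < r) (hr1 : r ≤ 1) :
    ∃ (N : ℕ) (p : ℝ), 1 ≤ p ∧ r + N * (r / p) = 1 := by
  rcases hr1.eq_or_lt with rfl | hlt
  · exact ⟨0, 1, le_rfl, by simp⟩
  obtain ⟨N, hN⟩ := exists_nat_ge ((1 - r) / r)
  have h1 : 0 < 1 - r := by linarith
  have hN0 : (0 : ℝ) < N := (div_pos h1 hr0).trans_le hN
  refine ⟨N, r * N / (1 - r), ?_, ?_⟩
  · rw [div_le_iff₀ hr0] at hN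
    rw [le_div_iff₀ h1]
    linarith
  · field_simp
    ring

theorem abs_le_one_add_tsum_rpow {d : ℕ → ℝ} {p : ℝ} (hp : 1 ≤ p) (hd : ∀ n, 0 ≤ d n)
    (hdp : Summable fun n => d n ^ p) (n : ℕ) : |d n| ≤ 1 + ∑' n, d n ^ p := by
  have h0 : ∀ n, 0 ≤ d n ^ p := fun n => Real.rpow_nonneg (hd n) p
  have h1 : d n ^ p ≤ ∑' n, d n ^ p := hdp.le_tsum n fun j _ => h0 j
  rw [abs_of_nonneg (hd n)]
  rcases le_total (d n) 1 with h | h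
  · linarith [h0 n]
  · linarith [Real.self_le_rpow_of_one_le h hp]

theorem diagonal_map_pow_apply {d : ℕ → ℝ} {D : Module.End ℂ ell2}
    (hD : ∀ z n, D z n = d n * z n) (N : ℕ) (z : ell2) (n : ℕ) :
    (D ^ N) z n = (d n : ℂ) ^ N * z n := by
  induction N with
  | zero => simp
  | succ N ih => rw [pow_succ', Module.End.mul_apply, hD, ih, pow_succ', mul_assoc]

/-- An `r`-nuclear operator factors through `ℓ²` as a square summable sequence of functionals,
a power of a diagonal operator, and a bounded operator. -/
theorem RNuclear.exists_factorization {X Y : Type*} [NormedAddCommGroup X] [NormedSpace ℂ X]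
    [NormedAddCommGroup Y] [NormedSpace ℂ Y] [CompleteSpace Y] {r p : ℝ} {N : ℕ}
    (hr0 : 0 < r) (hp : 1 ≤ p) (hrp : r + N * (r / p) = 1) {T : X →L[ℂ] Y}
    (hT : RNuclear r T) :
    ∃ (φ : ℕ → X →L[ℂ] ℂ) (d : ℕ → ℝ) (P : X →ₗ[ℂ] ell2) (D : Module.End ℂ ell2)
      (Q : ell2 →L[ℂ] Y), (Summable fun n => ‖φ n‖ ^ 2) ∧ (∀ n, 0 ≤ d n) ∧
      (Summable fun n => d n ^ p) ∧ (∀ x n, P x n = φ n x) ∧ (∀ z n, D z n = d n * z n) ∧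
      ∀ x, T x = Q ((D ^ N) (P x)) := by
  obtain ⟨μ, x', y, hx', hy, hμ, hT⟩ := hT
  have hp0 : 0 < p := by linarith
  let a : ℕ → ℝ := fun n => ‖μ n‖ ^ (r / 2)
  let b : ℕ → ℂ := fun n => μ n * ((‖μ n‖ ^ (1 - r / 2) : ℝ) : ℂ)⁻¹
  let d : ℕ → ℝ := fun n => ‖μ n‖ ^ (r / p)
  have ha0 : ∀ n, 0 ≤ a n := fun n => Real.rpow_nonneg (norm_nonneg _) _
  have ha : ∀ n, a n ^ 2 = ‖μ n‖ ^ r := fun n => by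
    rw [← Real.rpow_natCast, ← Real.rpow_mul (norm_nonneg _)]
    norm_num
  have hb : ∀ n, ‖b n‖ = a n := fun n => by
    simp only [b, a, norm_mul, norm_inv, Complex.norm_real,
      Real.norm_of_nonneg (Real.rpow_nonneg (norm_nonneg (μ n)) _)]
    rcases (norm_nonneg (μ n)).eq_or_lt with h | h
    · rw [← h, zero_mul, Real.zero_rpow (by linarith)]
    · rw [← div_eq_mul_inv, div_eq_iff (Real.rpow_pos_of_pos h _).ne', ← Real.rpow_add h]
      norm_num
  have hd : ∀ n, d n ^ p = ‖μ n‖ ^ r := fun n => by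
    rw [← Real.rpow_mul (norm_nonneg _), div_mul_cancel₀ _ hp0.ne']
  have habd : ∀ n, ((d n : ℂ) ^ N * a n) * b n = μ n := fun n => by
    simp only [b]
    rcases (norm_nonneg (μ n)).eq_or_lt with h | h
    · rw [norm_eq_zero.1 h.symm]
      simp
    · have h1 : d n ^ N * a n = ‖μ n‖ ^ (1 - r / 2) := by
        rw [← Real.rpow_natCast, ← Real.rpow_mul h.le, ← Real.rpow_add h]
        congr 1
        linarith
      rw [← Complex.ofReal_pow, ← Complex.ofReal_mul, h1, mul_left_comm, mul_inv_cancel₀, mul_one]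
      exact_mod_cast (Real.rpow_pos_of_pos h _).ne'
  let φ : ℕ → X →L[ℂ] ℂ := fun n => (a n : ℂ) • x' n
  have hφ : Summable fun n => ‖φ n‖ ^ 2 := by
    refine Summable.of_nonneg_of_le (fun _ => by positivity) (fun n => ?_) hμ
    rw [← ha n]
    refine pow_le_pow_left₀ (norm_nonneg _) ?_ 2
    rw [norm_smul, Complex.norm_real, Real.norm_of_nonneg (ha0 n)]
    exact mul_le_of_le_one_right (ha0 n) (hx' n)
  have hby : Summable fun n => ‖b n • y n‖ ^ 2 := by
    refine Summable.of_nonneg_of_le (fun _ => by positivity) (fun n => ?_) hμ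
    rw [← ha n]
    refine pow_le_pow_left₀ (norm_nonneg _) ?_ 2
    rw [norm_smul, hb]
    exact mul_le_of_le_one_right (ha0 n) (hy n)
  have hdp : Summable fun n => d n ^ p := by simpa only [hd] using hμ
  have hd0 : ∀ n, 0 ≤ d n := fun n => Real.rpow_nonneg (norm_nonneg _) _
  obtain ⟨P, hP⟩ := exists_analysis_map hφ
  obtain ⟨D, hD⟩ := exists_diagonal_map (abs_le_one_add_tsum_rpow hp hd0 hdp)
  obtain ⟨Q, hQ⟩ := exists_synthesis_map hby
  refine ⟨φ, d, P, D, Q, hφ, hd0, hdp, hP, hD, fun x => ?_⟩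
  rw [hT, hQ]
  refine tsum_congr fun n => ?_
  rw [diagonal_map_pow_apply hD, hP, smul_smul]
  congr 1
  rw [← habd n]
  simp only [φ, smul_apply, smul_eq_mul]
  ring

theorem rpow_mul_mul_prod_le {r p : ℝ} {N : ℕ} (hr0 : 0 < r) (hp : 1 ≤ p)
    (hrp : r + N * (r / p) = 1) {a b : ℝ} {δ : ℕ → ℝ} (ha : 0 ≤ a) (hb : 0 ≤ b)
    (hδ : ∀ j, 0 ≤ δ j) :
    (a * b * ∏ j ∈ Finset.range N, δ j) ^ r ≤
      r / 2 * a ^ 2 + r / 2 * b ^ 2 + r / p * ∑ j ∈ Finset.range N, δ j ^ p := by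
  have hp0 : 0 < p := by linarith
  let w : Option (Option (Fin N)) → ℝ :=
    fun o => o.elim (r / 2) fun o => o.elim (r / 2) fun _ => r / p
  let z : Option (Option (Fin N)) → ℝ :=
    fun o => o.elim (a ^ 2) fun o => o.elim (b ^ 2) fun j => δ j ^ p
  have hw : ∀ o ∈ Finset.univ, 0 ≤ w o := by
    rintro (_ | _ | _) - <;> simp only [w, Option.elim] <;> positivity
  have hz : ∀ o ∈ Finset.univ, 0 ≤ z o := by
    rintro (_ | _ | j) - <;> simp only [z, Option.elim]
    · positivity
    · positivity
    · exact Real.rpow_nonneg (hδ j) p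
  have hw1 : ∑ o, w o = 1 := by
    simp only [w, Fintype.sum_option, Option.elim, Finset.sum_const, Finset.card_univ,
      Fintype.card_fin, nsmul_eq_mul]
    linarith
  have hsq : ∀ {t : ℝ}, 0 ≤ t → (t ^ 2) ^ (r / 2) = t ^ r := fun ht => by
    rw [← Real.rpow_natCast, ← Real.rpow_mul ht]
    congr 1
    push_cast
    ring
  have h := Real.geom_mean_le_arith_mean_weighted Finset.univ w z hw hw1 hz
  simp only [w, z, Fintype.sum_option, Fintype.prod_option, Option.elim] at h
  have hδr : ∀ j : Fin N, (δ j ^ p) ^ (r / p) = δ j ^ r := fun j => by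
    rw [← Real.rpow_mul (hδ j), mul_div_cancel₀ _ hp0.ne']
  simp only [hsq ha, hsq hb, hδr] at h
  rw [Fin.prod_univ_eq_prod_range (fun j => δ j ^ r), ← Finset.mul_sum,
    Fin.sum_univ_eq_sum_range (fun j => δ j ^ p),
    Real.finsetProd_rpow _ _ (fun j _ => hδ j)] at h
  rw [Real.mul_rpow (mul_nonneg ha hb) (Finset.prod_nonneg fun j _ => hδ j),
    Real.mul_rpow ha hb, mul_assoc]
  linarith

open InnerProductSpace in
/-- The multiplicative Weyl-type bound for the diagonal of a triangular family. -/
theorem exists_sum_norm_rpow_le_of_triangular {X Y : Type*} [NormedAddCommGroup X]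
    [NormedSpace ℂ X] [CompleteSpace X] [NormedAddCommGroup Y] [NormedSpace ℂ Y]
    [CompleteSpace Y] {r : ℝ} (hr0 : 0 < r) (hr1 : r ≤ 1) {T : X →L[ℂ] Y} (hT : RNuclear r T)
    {U : Y →L[ℂ] X} (hU : RNuclear 1 U) :
    ∃ C : ℝ, ∀ {ι : Type} [Fintype ι] [LinearOrder ι] [LocallyFiniteOrderBot ι]
      [WellFoundedLT ι] (v : ι → X) (c : ι → ℂ), LinearIndependent ℂ v → (∀ i, c i ≠ 0) →
      (∀ i, U (T (v i)) - c i • v i ∈ Submodule.span ℂ (v '' Set.Iio i)) →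
      ∑ i, ‖c i‖ ^ r ≤ C := by
  obtain ⟨N, p, hp, hrp⟩ := exists_nat_real_add_mul_div_eq_one hr0 hr1
  obtain ⟨φ, d, P, D, Q, hφ, hd, hdp, hP, hD, hT⟩ := hT.exists_factorization hr0 hp hrp
  obtain ⟨ψ, -, P', D', Q', hψ, -, -, hP', -, hU⟩ :=
    hU.exists_factorization (N := 0) one_pos le_rfl (by simp)
  simp only [pow_zero, Module.End.one_apply] at hU
  refine ⟨r / 2 * (∑' n, ‖φ n‖ ^ 2 * ‖Q'‖ ^ 2) + r / 2 * (∑' n, ‖ψ n‖ ^ 2 * ‖Q‖ ^ 2) +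
    r / p * ∑ _j ∈ Finset.range N, ∑' n, d n ^ p, ?_⟩
  intro ι _ _ _ _ v c hv hc h
  let S : X →ₗ[ℂ] X := (U : Y →ₗ[ℂ] X) ∘ₗ (T : X →ₗ[ℂ] Y)
  have hS : LinearIndependent ℂ fun i => S (v i) := linearIndependent_of_triangular hv hc h
  let A : ell2 →ₗ[ℂ] ell2 := P ∘ₗ (Q' : ell2 →ₗ[ℂ] X)
  let B : ell2 →ₗ[ℂ] ell2 := P' ∘ₗ (Q : ell2 →ₗ[ℂ] Y)
  let u : ℕ → ι → ell2 := fun j i => (D ^ j) (P (v i))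
  let w : ι → ell2 := fun i => B (u N i)
  have hQw : ∀ i, Q' (w i) = S (v i) := fun i => by
    simp [w, B, u, S, hT, hU]
  have hw : LinearIndependent ℂ w :=
    LinearIndependent.of_comp (Q' : ell2 →ₗ[ℂ] X) (by convert hS using 1; exact funext hQw)
  have hu : ∀ j ≤ N, LinearIndependent ℂ (u j) := fun j hj => by
    refine LinearIndependent.of_comp (B ∘ₗ D ^ (N - j)) ?_
    convert hw using 1
    funext i
    simp only [Function.comp_apply, LinearMap.comp_apply, w, u]
    rw [← Module.End.mul_apply (D ^ (N - j)), ← pow_add, Nat.sub_add_cancel hj]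
  have hDt : ∀ j i, D (u j i) - (1 : ℂ) • u (j + 1) i ∈
      Submodule.span ℂ (u (j + 1) '' Set.Iio i) := fun j i => by
    simp [u, pow_succ', Module.End.mul_apply]
  have hBt : ∀ i, B (u N i) - (1 : ℂ) • w i ∈ Submodule.span ℂ (w '' Set.Iio i) := fun i => by
    simp [w]
  have hAt : ∀ i, A (w i) - c i • u 0 i ∈ Submodule.span ℂ (u 0 '' Set.Iio i) := fun i => by
    have h1 : A (w i) - c i • u 0 i = P (U (T (v i)) - c i • v i) := by
      rw [map_sub, map_smul, LinearMap.comp_apply]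
      congr 2
      exact hQw i
    have h2 := Submodule.mem_map_of_mem (f := P) (h i)
    rw [Submodule.map_span, ← Set.image_comp] at h2
    rwa [h1]
  let e : ℕ → ι → ell2 := fun j => gramSchmidtNormed ℂ (u j)
  let g : ι → ell2 := gramSchmidtNormed ℂ w
  have he : ∀ j ≤ N, Orthonormal ℂ (e j) := fun j hj => gramSchmidtNormed_orthonormal (hu j hj)
  have hg : Orthonormal ℂ g := gramSchmidtNormed_orthonormal hw
  have hfac : ∀ i, ‖c i‖ = ‖inner ℂ (e 0 i) (A (g i))‖ * ‖inner ℂ (g i) (B (e N i))‖ *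
      ∏ j ∈ Finset.range N, ‖inner ℂ (e (j + 1) i) (D (e j i))‖ := fun i => by
    have hn : ∀ j ≤ N, ‖gramSchmidt ℂ (u j) i‖ ≠ 0 := fun j hj =>
      norm_ne_zero_iff.2 (gramSchmidt_ne_zero i (hu j hj))
    have hnw : ‖gramSchmidt ℂ w i‖ ≠ 0 := norm_ne_zero_iff.2 (gramSchmidt_ne_zero i hw)
    have hprod : ∀ M ≤ N, ∏ j ∈ Finset.range M, ‖inner ℂ (e (j + 1) i) (D (e j i))‖ =
        ‖gramSchmidt ℂ (u M) i‖ / ‖gramSchmidt ℂ (u 0) i‖ := by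
      intro M hM
      induction M with
      | zero => simp [div_self (hn 0 (Nat.zero_le _))]
      | succ M ih =>
        rw [Finset.prod_range_succ, ih (by omega),
          norm_inner_gramSchmidtNormed_of_triangular (hDt M) i, norm_one, one_mul]
        have := hn M (by omega)
        have := hn 0 (Nat.zero_le _)
        field_simp
    rw [hprod N le_rfl, norm_inner_gramSchmidtNormed_of_triangular hAt i,
      norm_inner_gramSchmidtNormed_of_triangular hBt i, norm_one, one_mul]
    have := hn N le_rfl
    have := hn 0 (Nat.zero_le _)
    field_simp
  calc ∑ i, ‖c i‖ ^ r
      ≤ ∑ i, (r / 2 * ‖inner ℂ (e 0 i) (A (g i))‖ ^ 2 +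
          r / 2 * ‖inner ℂ (g i) (B (e N i))‖ ^ 2 +
          r / p * ∑ j ∈ Finset.range N, ‖inner ℂ (e (j + 1) i) (D (e j i))‖ ^ p) := by
        refine Finset.sum_le_sum fun i _ => ?_
        rw [hfac i]
        exact rpow_mul_mul_prod_le hr0 hp hrp (norm_nonneg _) (norm_nonneg _)
          (δ := fun j => ‖inner ℂ (e (j + 1) i) (D (e j i))‖) fun _ => norm_nonneg _
    _ = r / 2 * ∑ i, ‖inner ℂ (e 0 i) (A (g i))‖ ^ 2 +
          r / 2 * ∑ i, ‖inner ℂ (g i) (B (e N i))‖ ^ 2 +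
          r / p * ∑ j ∈ Finset.range N, ∑ i, ‖inner ℂ (e (j + 1) i) (D (e j i))‖ ^ p := by
        rw [Finset.sum_add_distrib, Finset.sum_add_distrib, ← Finset.mul_sum, ← Finset.mul_sum,
          ← Finset.mul_sum, Finset.sum_comm]
    _ ≤ _ := by
        have hp0 : 0 < p := by linarith
        gcongr with j hj
        · exact sum_norm_inner_analysis_sq_le hφ hP Q' hg (he 0 (Nat.zero_le _))
        · exact sum_norm_inner_analysis_sq_le hψ hP' Q (he N le_rfl) hg
        · have hj' := Finset.mem_range.1 hj
          exact sum_norm_inner_diagonal_rpow_le hp hd hdp (abs_le_one_add_tsum_rpow hp hd hdp) hD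
            (he j hj'.le) (he (j + 1) hj')

end NuclearFactorization

section TriangularFamilies

open Module.End in
/-- If a subspace does not contain a generalized eigenspace, some generalized eigenvector outside
of it is an eigenvector modulo the subspace. -/
theorem exists_mem_maxGenEigenspace_notMem {V : Type*} [AddCommGroup V] [Module ℂ V]
    (S : Module.End ℂ V) (μ : ℂ) {W : Submodule ℂ V} (hW : ¬ S.maxGenEigenspace μ ≤ W) :
    ∃ x ∈ S.maxGenEigenspace μ, x ∉ W ∧ S x - μ • x ∈ W := by
  obtain ⟨x, hx, hxW⟩ := SetLike.not_le_iff_exists.1 hW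
  obtain ⟨m, hm⟩ := (mem_maxGenEigenspace S μ x).1 hx
  have hex : ∃ j, ((S - μ • (1 : Module.End ℂ V)) ^ j) x ∈ W := ⟨m, hm ▸ W.zero_mem⟩
  classical
  have hpos : Nat.find hex ≠ 0 := fun h0 => hxW (by simpa [h0] using Nat.find_spec hex)
  obtain ⟨j, hj⟩ := Nat.exists_eq_succ_of_ne_zero hpos
  refine ⟨((S - μ • (1 : Module.End ℂ V)) ^ j) x, ?_, Nat.find_min hex (by omega), ?_⟩
  · rw [mem_maxGenEigenspace]
    refine ⟨m, ?_⟩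
    rw [← Module.End.mul_apply, ← pow_add, add_comm, pow_add, Module.End.mul_apply, hm, map_zero]
  · have h := Nat.find_spec hex
    rw [hj, pow_succ', Module.End.mul_apply] at h
    simpa using h

/-- A sequence in which no scalar is repeated more often than the dimension of its generalized
eigenspace allows is, up to its zero terms, the diagonal of a triangular family. -/
theorem exists_triangular_family {V : Type*} [AddCommGroup V] [Module ℂ V]
    (S : Module.End ℂ V) (lam : ℕ → ℂ)
    (hcount : ∀ n, lam n ≠ 0 → FiniteDimensional ℂ (S.maxGenEigenspace (lam n)) →
      ((Finset.range n).filter fun j => lam j = lam n).card <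
        Module.finrank ℂ (S.maxGenEigenspace (lam n))) (k : ℕ) :
    ∃ v : ℕ → V, LinearIndepOn ℂ v {j | j < k ∧ lam j ≠ 0} ∧
      (∀ n < k, lam n ≠ 0 → v n ∈ S.maxGenEigenspace (lam n)) ∧
      ∀ n < k, lam n ≠ 0 →
        S (v n) - lam n • v n ∈ Submodule.span ℂ (v '' {j | j < n ∧ lam j ≠ 0}) := by
  induction k with
  | zero => exact ⟨0, by simp, by simp, by simp⟩
  | succ k ih =>
    obtain ⟨v, hv, hmem, htri⟩ := ih
    by_cases hk : lam k = 0
    · have hset : {j | j < k + 1 ∧ lam j ≠ 0} = {j | j < k ∧ lam j ≠ 0} := by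
        ext j
        simp only [Set.mem_ofPred_eq]
        refine ⟨fun h => ⟨?_, h.2⟩, fun h => ⟨by omega, h.2⟩⟩
        have : j ≠ k := fun hjk => h.2 (hjk ▸ hk)
        omega
      have hlt : ∀ n < k + 1, lam n ≠ 0 → n < k := fun n hn h0 => by
        have : n ≠ k := fun hnk => h0 (hnk ▸ hk)
        omega
      refine ⟨v, hset ▸ hv, fun n hn h0 => hmem n (hlt n hn h0) h0,
        fun n hn h0 => htri n (hlt n hn h0) h0⟩
    set μ := lam k with hμ
    let J : Finset ℕ := (Finset.range k).filter fun j => lam j = μ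
    let W₁ : Submodule ℂ V := Submodule.span ℂ (v '' J)
    let W : Submodule ℂ V := Submodule.span ℂ (v '' {j | j < k ∧ lam j ≠ 0})
    have hW₁ : W₁ ≤ S.maxGenEigenspace μ := by
      rw [Submodule.span_le]
      rintro _ ⟨j, hj, rfl⟩
      obtain ⟨hj1, hj2⟩ := Finset.mem_filter.1 (Finset.mem_coe.1 hj)
      exact hj2 ▸ hmem j (Finset.mem_range.1 hj1) (hj2 ▸ hk)
    have hWle : W ≤ W₁ ⊔ ⨆ ν, ⨆ (_ : ν ≠ μ), S.maxGenEigenspace ν := by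
      rw [Submodule.span_le]
      rintro _ ⟨j, ⟨hj1, hj2⟩, rfl⟩
      by_cases hj : lam j = μ
      · refine Submodule.mem_sup_left (Submodule.subset_span ⟨j, ?_, rfl⟩)
        exact Finset.mem_coe.2 (Finset.mem_filter.2 ⟨Finset.mem_range.2 hj1, hj⟩)
      · exact Submodule.mem_sup_right (Submodule.mem_iSup_of_mem (lam j)
          (Submodule.mem_iSup_of_mem hj (hmem j hj1 hj2)))
    have hnot : ¬ S.maxGenEigenspace μ ≤ W := by
      intro hle
      have hle₁ : S.maxGenEigenspace μ ≤ W₁ := by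
        have h1 := le_inf (hle.trans hWle) (le_refl (S.maxGenEigenspace μ))
        rwa [sup_inf_assoc_of_le _ hW₁, inf_comm,
          ((Module.End.independent_maxGenEigenspace S) μ).eq_bot, sup_bot_eq] at h1
      have hfin : FiniteDimensional ℂ W₁ :=
        FiniteDimensional.span_of_finite ℂ (J.finite_toSet.image v)
      have hfinG : FiniteDimensional ℂ (S.maxGenEigenspace μ) :=
        Submodule.finiteDimensional_of_le hle₁
      have h2 : J.card < Module.finrank ℂ (S.maxGenEigenspace μ) := hcount k hk hfinG
      have h3 : Module.finrank ℂ W₁ ≤ J.card := by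
        classical
        have h4 := finrank_span_finset_le_card (R := ℂ) (J.image v)
        rw [Set.finrank, Finset.coe_image] at h4
        exact h4.trans Finset.card_image_le
      exact absurd (Submodule.finrank_mono hle₁) (by omega)
    obtain ⟨x, hxG, hxW, hxS⟩ := exists_mem_maxGenEigenspace_notMem S μ hnot
    have hne : ∀ j < k, Function.update v k x j = v j := fun j hj =>
      Function.update_of_ne (by omega) _ _
    have heq : ∀ n ≤ k, Function.update v k x '' {j | j < n ∧ lam j ≠ 0} =
        v '' {j | j < n ∧ lam j ≠ 0} := fun n hn =>
      Set.image_congr fun j hj => hne j (hj.1.trans_le hn)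
    refine ⟨Function.update v k x, ?_, ?_, ?_⟩
    · have hset : {j | j < k + 1 ∧ lam j ≠ 0} = insert k {j | j < k ∧ lam j ≠ 0} := by
        ext j
        simp only [Set.mem_ofPred_eq, Set.mem_insert_iff]
        constructor
        · rintro ⟨h1, h2⟩
          rcases Nat.lt_succ_iff_lt_or_eq.1 h1 with h | h
          · exact Or.inr ⟨h, h2⟩
          · exact Or.inl h
        · rintro (rfl | ⟨h1, h2⟩)
          · exact ⟨by omega, hk⟩
          · exact ⟨by omega, h2⟩
      rw [hset]
      refine LinearIndepOn.insert (hv.congr fun j hj => (hne j hj.1).symm) ?_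
      rwa [heq k le_rfl, Function.update_self]
    · intro n hn h0
      rcases Nat.lt_succ_iff_lt_or_eq.1 hn with h | rfl
      · rw [hne n h]
        exact hmem n h h0
      · rwa [Function.update_self]
    · intro n hn h0
      rcases Nat.lt_succ_iff_lt_or_eq.1 hn with h | rfl
      · rw [hne n h, heq n h.le]
        exact htri n h h0
      · rwa [Function.update_self, heq n le_rfl]

theorem algebraicMultiplicity_eq_finrank_maxGenEigenspace {Z : Type*} [NormedAddCommGroup Z]
    [NormedSpace ℂ Z] (S : Z →L[ℂ] Z) (μ : ℂ) :
    algebraicMultiplicity S μ =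
      Module.finrank ℂ (Module.End.maxGenEigenspace (S : Z →ₗ[ℂ] Z) μ) := by
  have h : (⨆ k : ℕ, LinearMap.ker
      ((((S - μ • (1 : Z →L[ℂ] Z)) ^ k : Z →L[ℂ] Z)) : Z →ₗ[ℂ] Z)) =
      Module.End.maxGenEigenspace (S : Z →ₗ[ℂ] Z) μ := by
    rw [← Module.End.iSup_genEigenspace_eq]
    refine iSup_congr fun k => ?_
    rw [Module.End.genEigenspace_nat, ContinuousLinearMap.toLinearMap_pow]
    rfl
  rw [algebraicMultiplicity, h]

theorem IsEigenvalueSeq.card_filter_lt_finrank {Z : Type*} [NormedAddCommGroup Z]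
    [NormedSpace ℂ Z] {S : Z →L[ℂ] Z} {lam : ℕ → ℂ} (h : IsEigenvalueSeq S lam) {n : ℕ}
    (hn : lam n ≠ 0)
    (hfin : FiniteDimensional ℂ (Module.End.maxGenEigenspace (S : Z →ₗ[ℂ] Z) (lam n))) :
    ((Finset.range n).filter fun j => lam j = lam n).card <
      Module.finrank ℂ (Module.End.maxGenEigenspace (S : Z →ₗ[ℂ] Z) (lam n)) := by
  have hcard := h.2 (lam n) hn
  rw [algebraicMultiplicity_eq_finrank_maxGenEigenspace] at hcard
  obtain ⟨x, hx0, hx⟩ := h.1 n hn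
  have hpos : 0 < Module.finrank ℂ (Module.End.maxGenEigenspace (S : Z →ₗ[ℂ] Z) (lam n)) := by
    rw [Module.finrank_pos_iff_exists_ne_zero]
    refine ⟨⟨x, Module.End.eigenspace_le_maxGenEigenspace
      (Module.End.mem_eigenspace_iff.2 hx)⟩, fun h0 => hx0 (congrArg Subtype.val h0)⟩
  have hfinite : Set.Finite {j | lam j = lam n} := by
    rw [← Set.finite_coe_iff]
    exact Nat.finite_of_card_ne_zero (hcard.trans_ne hpos.ne')
  rw [← hcard, ← Set.ncard_coe_finset]
  refine Set.ncard_lt_ncard ?_ hfinite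
  refine (Set.ssubset_iff_of_subset fun j hj => ?_).2 ⟨n, rfl, fun hmem => ?_⟩
  · exact (Finset.mem_filter.1 (Finset.mem_coe.1 hj)).2
  · simpa using (Finset.mem_filter.1 (Finset.mem_coe.1 hmem)).1

end TriangularFamilies

noncomputable section

/-- Let `0 < r ≤ 1`, `T : X → Y` an `r`-nuclear operator and
`U : Y → X` a nuclear (1-nuclear) operator between Banach spaces. Then the eigenvalue
sequence of `U ∘ T : X → X` belongs to `ℓ^r`. -/
theorem eigenvalues_of_nuclear_comp_rNuclear_mem_lr
    {X Y : Type*} [NormedAddCommGroup X] [NormedSpace ℂ X] [CompleteSpace X]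
    [NormedAddCommGroup Y] [NormedSpace ℂ Y] [CompleteSpace Y]
    (r : ℝ) (hr0 : 0 < r) (hr1 : r ≤ 1)
    (T : X →L[ℂ] Y) (hT : RNuclear r T) (U : Y →L[ℂ] X) (hU : RNuclear 1 U)
    (lam : ℕ → ℂ) (hlam : IsEigenvalueSeq (U.comp T) lam) :
    Summable fun n => ‖lam n‖ ^ r := by
  obtain ⟨C, hC⟩ := exists_sum_norm_rpow_le_of_triangular hr0 hr1 hT hU
  refine summable_of_sum_range_le (c := C) (fun n => by positivity) fun k => ?_
  obtain ⟨v, hv, -, htri⟩ := exists_triangular_family (U.comp T : X →ₗ[ℂ] X) lam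
    (fun n hn hfin => hlam.card_filter_lt_finrank hn hfin) k
  let s : Set ℕ := {j | j < k ∧ lam j ≠ 0}
  have hs : s.Finite := (Set.finite_lt_nat k).subset fun j hj => hj.1
  have : Fintype s := hs.fintype
  have : LocallyFiniteOrderBot s := LocallyFiniteOrderBot.ofIic' s
    (fun i => Finset.univ.filter fun j => j ≤ i) (by simp)
  have h := hC (fun i : s => v i) (fun i => lam i) hv (fun i => i.2.2) fun i => by
    have hset : (fun i : s => v i) '' Set.Iio i = v '' {j | j < i ∧ lam j ≠ 0} := by
      ext x
      constructor
      · rintro ⟨j, hj, rfl⟩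
        exact ⟨j, ⟨hj, j.2.2⟩, rfl⟩
      · rintro ⟨j, ⟨hj, hj0⟩, rfl⟩
        exact ⟨⟨j, hj.trans i.2.1, hj0⟩, hj, rfl⟩
    rw [hset]
    exact htri i i.2.1 i.2.2
  refine le_trans (le_of_eq ?_) h
  rw [← Finset.sum_subtype ((Finset.range k).filter fun j => lam j ≠ 0) (p := (· ∈ s))
    (fun j => by simp [s]) fun j => ‖lam j‖ ^ r]
  refine (Finset.sum_filter_of_ne (p := fun j => lam j ≠ 0) fun j _ hj h0 => hj ?_).symm
  rw [h0, norm_zero, Real.zero_rpow hr0.ne']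

end
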